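/- Let 1<p₁,p₂<∞ and 0<α<2n. Let b be a real-valued BMO function with ‖b‖_{BMO} = 1, let Q_j be a cube with center y_j satisfying ⨍_{Q_j}|b − b_{Q_j}| ≥ ε for some ε>0, and let f_j and g_j be the associated test functions. Then for all x outside the cube 2√n·Q_j (the cube concentric with Q_j with side length 2√n times that of Q_j), |I_α((b−b_{Q_j})f_j, g_j)(x)| ≤ C |Q_j|^{1/p₁' + 1/p₂'} |x−y_j|^{−2n+α}, where C is independent of b, ε, Q_j, and x. -/

import Mathlib

open MeasureTheory Set Filter
open scoped ENNReal BigOperators Topology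

noncomputable section

/-- Euclidean space `ℝⁿ`. -/
abbrev Rn (n : ℕ) : Type := EuclideanSpace ℝ (Fin n)

/-- The closed axis-parallel cube with center `c` and side length `d`. -/
def cube (n : ℕ) (c : Rn n) (d : ℝ) : Set (Rn n) :=
  {x | ∀ i : Fin n, |x i - c i| ≤ d / 2}

/-- The average `b_Q` of `b` over the cube with center `c` and side length `d`. -/
def cubeAvg (n : ℕ) (b : Rn n → ℝ) (c : Rn n) (d : ℝ) : ℝ :=
  ⨍ x in cube n c d, b x

/-- The mean oscillation `⨍_Q |b - b_Q|` of `b` over a cube. -/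
def osc (n : ℕ) (b : Rn n → ℝ) (c : Rn n) (d : ℝ) : ℝ :=
  ⨍ x in cube n c d, |b x - cubeAvg n b c d|

/-- The BMO seminorm: supremum of mean oscillations over all axis-parallel cubes. -/
def bmoNorm (n : ℕ) (b : Rn n → ℝ) : ℝ :=
  ⨆ cd : Rn n × {d : ℝ // 0 < d}, osc n b cd.1 cd.2.1

/-- `b ∈ CMO`: `b` belongs to the closure of `C_c^∞` in the BMO seminorm. -/
def MemCMO (n : ℕ) (b : Rn n → ℝ) : Prop :=
  ∀ ε : ℝ, 0 < ε → ∃ φ : Rn n → ℝ, ContDiff ℝ (⊤ : ℕ∞) φ ∧ HasCompactSupport φ ∧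
    bmoNorm n (b - φ) < ε

/-- The conjugate exponent `p' = p/(p-1)`. -/
def conjExp (p : ℝ) : ℝ := p / (p - 1)

/-- The Muckenhoupt class `A_p`. -/
def MuckenhouptAp (n : ℕ) (p : ℝ) (w : Rn n → ℝ) : Prop :=
  (∀ x, 0 ≤ w x) ∧ LocallyIntegrable w volume ∧
  ∃ C : ℝ, ∀ (c : Rn n) (d : ℝ), 0 < d →
    (⨍ x in cube n c d, w x) *
      (⨍ x in cube n c d, w x ^ (1 - conjExp p)) ^ (p / conjExp p) ≤ C

/-- The `A_p` characteristic constant `[w]_{A_p}`. -/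
def apConst (n : ℕ) (p : ℝ) (w : Rn n → ℝ) : ℝ :=
  ⨆ cd : Rn n × {d : ℝ // 0 < d},
    (⨍ x in cube n cd.1 cd.2.1, w x) *
      (⨍ x in cube n cd.1 cd.2.1, w x ^ (1 - conjExp p)) ^ (p / conjExp p)

/-- The bilinear class `A_{P,q}` for `P = (p₁,p₂)`. -/
def MuckenhouptAPq (n : ℕ) (p₁ p₂ q : ℝ) (w₁ w₂ : Rn n → ℝ) : Prop :=
  ∃ C : ℝ, ∀ (c : Rn n) (d : ℝ), 0 < d →
    (⨍ x in cube n c d, (w₁ x * w₂ x) ^ q) *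
      (⨍ x in cube n c d, w₁ x ^ (-(conjExp p₁))) ^ (q / conjExp p₁) *
      (⨍ x in cube n c d, w₂ x ^ (-(conjExp p₂))) ^ (q / conjExp p₂) ≤ C

/-- The kernel of the bilinear fractional integral `I_α`. -/
def fracKernel (n : ℕ) (α : ℝ) (x y z : Rn n) : ℝ :=
  (‖x - y‖ ^ 2 + ‖x - z‖ ^ 2) ^ (-((n : ℝ) - α / 2))

/-- The bilinear fractional integral operator `I_α`. -/
def Iop (n : ℕ) (α : ℝ) (f g : Rn n → ℝ) (x : Rn n) : ℝ :=
  ∫ y, ∫ z, fracKernel n α x y z * (f y * g z)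

/-- The first commutator `[b, I_α]₁(f,g) = I_α(bf, g) - b · I_α(f,g)`. -/
def commI (n : ℕ) (α : ℝ) (b f g : Rn n → ℝ) : Rn n → ℝ :=
  fun x => Iop n α (fun y => b y * f y) g x - b x * Iop n α f g x

/-- The weighted Lᵖ norm `(∫ |f|^p w)^{1/p}` (with value in `ℝ≥0∞`). -/
def wNorm (n : ℕ) (p : ℝ) (w : Rn n → ℝ) (f : Rn n → ℝ) : ℝ≥0∞ :=
  (∫⁻ x, ENNReal.ofReal (|f x| ^ p * w x)) ^ (1 / p)

/-- A bilinear operator `T` is compact from `L^{p₁}(w₁) × L^{p₂}(w₂)` to `L^q(μ)` when the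
image of the product of unit balls is precompact in `L^q(μ)`; equivalently (by completeness),
every sequence in the image of the unit balls admits a subsequence which is Cauchy for the
`L^q(μ)` norm. -/
def BilinCompact (n : ℕ) (p₁ p₂ q : ℝ) (w₁ w₂ μ : Rn n → ℝ)
    (T : (Rn n → ℝ) → (Rn n → ℝ) → Rn n → ℝ) : Prop :=
  ∀ F G : ℕ → Rn n → ℝ,
    (∀ j, wNorm n p₁ w₁ (F j) ≤ 1) → (∀ j, wNorm n p₂ w₂ (G j) ≤ 1) →
    ∃ φ : ℕ → ℕ, StrictMono φ ∧
      ∀ ε : ℝ, 0 < ε → ∃ N : ℕ, ∀ j ≥ N, ∀ k ≥ N,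
        wNorm n q μ (fun x => T (F (φ j)) (G (φ j)) x - T (F (φ k)) (G (φ k)) x)
          < ENNReal.ofReal ε

/-- The smoothly truncated kernel `K^δ` with implicit constant `A`. -/
def IsTruncKernel (n : ℕ) (α δ A : ℝ) (K : Rn n → Rn n → Rn n → ℝ) : Prop :=
  ContDiff ℝ 1 (fun pt : Rn n × Rn n × Rn n => K pt.1 pt.2.1 pt.2.2) ∧
  (∀ x y z, 2 * δ < max ‖x - y‖ ‖x - z‖ → K x y z = fracKernel n α x y z) ∧
  (∀ x y z, max ‖x - y‖ ‖x - z‖ < δ → K x y z = 0) ∧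
  (∀ x y z : Rn n, |K x y z| ≤ A * (‖x - y‖ + ‖x - z‖) ^ (-(2 * (n : ℝ) - α))) ∧
  (∀ x y z : Rn n,
    ‖fderiv ℝ (fun pt : Rn n × Rn n × Rn n => K pt.1 pt.2.1 pt.2.2) (x, y, z)‖ ≤
      A * (‖x - y‖ + ‖x - z‖) ^ (-(2 * (n : ℝ) - α - 1)))

/-- The bilinear operator with kernel `K`. -/
def IopK (n : ℕ) (K : Rn n → Rn n → Rn n → ℝ) (f g : Rn n → ℝ) (x : Rn n) : ℝ :=
  ∫ y, ∫ z, K x y z * (f y * g z)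

/-- The first commutator of the truncated operator. -/
def commIK (n : ℕ) (K : Rn n → Rn n → Rn n → ℝ) (b f g : Rn n → ℝ) : Rn n → ℝ :=
  fun x => IopK n K (fun y => b y * f y) g x - b x * IopK n K f g x

/-- The bilinear fractional maximal function `M_α`. -/
def Mmax (n : ℕ) (α : ℝ) (f g : Rn n → ℝ) (x : Rn n) : ℝ :=
  ⨆ cd : {cd : Rn n × ℝ // 0 < cd.2 ∧ x ∈ cube n cd.1 cd.2},
    ((cd : Rn n × ℝ).2 ^ n) ^ (α / n) *
      ((⨍ y in cube n (cd : Rn n × ℝ).1 (cd : Rn n × ℝ).2, |f y|) *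
        (⨍ z in cube n (cd : Rn n × ℝ).1 (cd : Rn n × ℝ).2, |g z|))

/-- The test function `f_j` associated to the cube with center `c`, side `d` and symbol `b`:
`f_j = |Q|^{-1/p₁} (sgn(b - b_Q) - c₀) χ_Q` where `c₀ = ⨍_Q sgn(b - b_Q)`. -/
def testF (n : ℕ) (p₁ : ℝ) (b : Rn n → ℝ) (c : Rn n) (d : ℝ) : Rn n → ℝ :=
  indicator (cube n c d) fun y =>
    (d ^ n) ^ (-(1 / p₁)) *
      (Real.sign (b y - cubeAvg n b c d) -
        ⨍ z in cube n c d, Real.sign (b z - cubeAvg n b c d))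

/-- The test function `g_j = |Q|^{-1/p₂} χ_Q` associated to the cube with center `c`, side `d`. -/
def testG (n : ℕ) (p₂ : ℝ) (c : Rn n) (d : ℝ) : Rn n → ℝ :=
  indicator (cube n c d) fun _ => (d ^ n) ^ (-(1 / p₂))

end

theorem aux_cube_eq (n : ℕ) (c : Rn n) (d : ℝ) :
    cube n c d = (@WithLp.ofLp 2 (Fin n → ℝ)) ⁻¹'
      (Icc (fun i => c i - d / 2) (fun i => c i + d / 2)) := by
  ext x
  simp only [cube, mem_ofPred_eq, mem_preimage, mem_Icc, Pi.le_def, abs_le]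
  constructor
  · intro h
    exact ⟨fun i => by linarith [(h i).1], fun i => by linarith [(h i).2]⟩
  · rintro ⟨h1, h2⟩ i
    exact ⟨by linarith [h1 i], by linarith [h2 i]⟩

theorem aux_cube_meas (n : ℕ) (c : Rn n) (d : ℝ) : MeasurableSet (cube n c d) := by
  rw [aux_cube_eq]
  exact (PiLp.volume_preserving_ofLp (Fin n)).measurable measurableSet_Icc

theorem aux_cube_vol (n : ℕ) (c : Rn n) (d : ℝ) (hd : 0 < d) :
    volume (cube n c d) = ENNReal.ofReal (d ^ n) := by
  rw [aux_cube_eq, (PiLp.volume_preserving_ofLp (Fin n)).measure_preimage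
    measurableSet_Icc.nullMeasurableSet, Real.volume_Icc_pi]
  have : ∀ i : Fin n, c i + d / 2 - (c i - d / 2) = d := fun i => by ring
  simp only [this, Finset.prod_const, Finset.card_univ, Fintype.card_fin]
  rw [ENNReal.ofReal_pow hd.le]

theorem aux_cube_norm (n : ℕ) (c : Rn n) (d : ℝ) (hd : 0 < d) (y : Rn n)
    (hy : y ∈ cube n c d) : ‖y - c‖ ≤ Real.sqrt n * (d / 2) := by
  rw [EuclideanSpace.norm_eq]
  have h : ∑ i, ‖(y - c) i‖ ^ 2 ≤ n * (d / 2) ^ 2 := by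
    calc ∑ i, ‖(y - c) i‖ ^ 2 ≤ ∑ _i : Fin n, (d / 2) ^ 2 := by
          apply Finset.sum_le_sum
          intro i _
          have := hy i
          exact pow_le_pow_left₀ (norm_nonneg _) (by simpa using this) 2
      _ = n * (d / 2) ^ 2 := by simp
  refine (Real.sqrt_le_sqrt h).trans ?_
  rw [Real.sqrt_mul (Nat.cast_nonneg n), Real.sqrt_sq (by positivity)]

theorem aux_far (n : ℕ) (c : Rn n) (d : ℝ) (hd : 0 < d) (x y : Rn n)
    (hx : x ∉ cube n c (2 * Real.sqrt n * d)) (hy : y ∈ cube n c d) :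
    0 < ‖x - c‖ ∧ ‖x - c‖ / 2 ≤ ‖x - y‖ := by
  have h1 := aux_cube_norm n c d hd y hy
  simp only [cube, mem_ofPred_eq, not_forall, not_le] at hx
  obtain ⟨i, hi⟩ := hx
  have h2 : |x i - c i| ≤ ‖x - c‖ := by
    simpa using PiLp.norm_apply_le (x - c) i
  have h3 : ‖x - c‖ ≤ ‖x - y‖ + ‖y - c‖ := norm_sub_le_norm_sub_add_norm_sub x y c
  have h4 : 0 ≤ Real.sqrt n * d := by positivity
  constructor
  · linarith
  · linarith

theorem aux_kernel (n : ℕ) (α : ℝ) (hα₂ : α < 2 * n) (c : Rn n) (d : ℝ) (hd : 0 < d)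
    (x y z : Rn n) (hx : x ∉ cube n c (2 * Real.sqrt n * d)) (hy : y ∈ cube n c d)
    (hz : z ∈ cube n c d) :
    |fracKernel n α x y z| ≤
      (2 : ℝ) ^ ((n : ℝ) - α / 2) * ‖x - c‖ ^ (-(2 * (n : ℝ)) + α) := by
  obtain ⟨hr, h1⟩ := aux_far n c d hd x y hx hy
  obtain ⟨_, h2⟩ := aux_far n c d hd x z hx hz
  unfold fracKernel
  rw [abs_of_nonneg (by positivity)]
  have h3 : ‖x - c‖ ^ 2 / 2 ≤ ‖x - y‖ ^ 2 + ‖x - z‖ ^ 2 := by nlinarith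
  refine (Real.rpow_le_rpow_of_nonpos (by positivity) h3 (by linarith)).trans ?_
  rw [Real.div_rpow (by positivity) (by positivity), ← Real.rpow_natCast, ← Real.rpow_mul hr.le,
    Real.rpow_neg (by norm_num : (0:ℝ) ≤ 2), div_inv_eq_mul, mul_comm]
  apply le_of_eq
  congr 2
  push_cast
  ring

theorem aux_osc_le (n : ℕ) (b : Rn n → ℝ) (hb : bmoNorm n b = 1) (c : Rn n) (d : ℝ)
    (hd : 0 < d) : osc n b c d ≤ 1 := by
  have hbdd : BddAbove (range fun cd : Rn n × {d : ℝ // 0 < d} => osc n b cd.1 cd.2.1) := by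
    by_contra h
    have := Real.iSup_of_not_bddAbove h
    unfold bmoNorm at hb
    rw [hb] at this
    exact one_ne_zero this
  rw [← hb]
  exact le_ciSup hbdd (c, ⟨d, hd⟩)

theorem aux_sign_avg (n : ℕ) (h : Rn n → ℝ) (c : Rn n) (d : ℝ) (hd : 0 < d) :
    |⨍ z in cube n c d, Real.sign (h z)| ≤ 1 := by
  have hv := aux_cube_vol n c d hd
  have hr : volume.real (cube n c d) = d ^ n := by
    rw [measureReal_def, hv, ENNReal.toReal_ofReal (by positivity)]
  rw [setAverage_eq, hr, smul_eq_mul, abs_mul, abs_of_nonneg (by positivity : 0 ≤ (d ^ n)⁻¹)]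
  have : ‖∫ z in cube n c d, Real.sign (h z)‖ ≤ 1 * volume.real (cube n c d) := by
    apply norm_setIntegral_le_of_norm_le_const
    · rw [hv]; exact ENNReal.ofReal_lt_top
    · intro z _
      rcases Real.sign_apply_eq (h z) with h | h | h <;> rw [h] <;> norm_num
  rw [hr, Real.norm_eq_abs, one_mul] at this
  calc (d ^ n)⁻¹ * _ ≤ (d ^ n)⁻¹ * d ^ n := by gcongr
    _ = 1 := inv_mul_cancel₀ (by positivity)

/-- (Pointwise upper bound, Estimate (7).) There is `C`, independent of
`b`, `ε`, the cube and `x`, such that for any real-valued `b` with `‖b‖_{BMO} = 1`, any cube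
`Q_j` (center `y_j`, side `d_j`) with `⨍_{Q_j}|b-b_{Q_j}| ≥ ε`, and any `x ∉ 2√n Q_j`,
`|I_α((b-b_{Q_j})f_j, g_j)(x)| ≤ C |Q_j|^{1/p₁'+1/p₂'} |x-y_j|^{-2n+α}`. -/
theorem statement11 (n : ℕ) (hn : 0 < n) (p₁ p₂ α : ℝ)
    (hp₁ : 1 < p₁) (hp₂ : 1 < p₂)
    (hα₀ : 0 < α) (hα₂ : α < 2 * n) :
    ∃ C : ℝ, ∀ b : Rn n → ℝ, LocallyIntegrable b volume → bmoNorm n b = 1 →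
      ∀ ε : ℝ, 0 < ε →
        ∀ (yj : Rn n) (dj : ℝ), 0 < dj → ε ≤ osc n b yj dj →
          ∀ x : Rn n, x ∉ cube n yj (2 * Real.sqrt n * dj) →
            |Iop n α (fun y => (b y - cubeAvg n b yj dj) * testF n p₁ b yj dj y)
                (testG n p₂ yj dj) x| ≤
              C * (dj ^ n) ^ (1 / conjExp p₁ + 1 / conjExp p₂) *
                ‖x - yj‖ ^ (-(2 * (n : ℝ)) + α) := by
  refine ⟨2 * (2 : ℝ) ^ ((n : ℝ) - α / 2), ?_⟩
  intro b hbl hb ε _ c d hd _ x hx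
  set Q := cube n c d with hQ
  set m := cubeAvg n b c d with hm
  set M : ℝ := (2 : ℝ) ^ ((n : ℝ) - α / 2) * ‖x - c‖ ^ (-(2 * (n : ℝ)) + α) with hM
  have hM0 : 0 ≤ M := by positivity
  have hQm : MeasurableSet Q := aux_cube_meas n c d
  have hv : volume Q = ENNReal.ofReal (d ^ n) := aux_cube_vol n c d hd
  have hvfin : volume Q ≠ ∞ := by rw [hv]; exact ENNReal.ofReal_ne_top
  have hr : volume.real Q = d ^ n := by
    rw [measureReal_def, hv, ENNReal.toReal_ofReal (by positivity)]
  have hV : 0 < d ^ n := by positivity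
  have hfin : IsFiniteMeasure (volume.restrict Q) := ⟨by simpa using hvfin.lt_top⟩
  -- integrability of b on Q
  have hsub : Q ⊆ Metric.closedBall c (Real.sqrt n * (d / 2)) := by
    intro y hy
    rw [mem_closedBall_iff_norm]
    exact aux_cube_norm n c d hd y hy
  have hbQ : IntegrableOn b Q :=
    (hbl.integrableOn_isCompact (isCompact_closedBall c _)).mono_set hsub
  have hbQ' : IntegrableOn (fun y => |b y - m|) Q :=
    (Integrable.sub hbQ (integrable_const m)).abs
  have hosc : ∫ y in Q, |b y - m| ≤ d ^ n := by
    have h1 := aux_osc_le n b hb c d hd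
    unfold osc at h1
    rw [setAverage_eq, ← hQ, ← hm, hr, smul_eq_mul, inv_mul_le_iff₀ hV, mul_one] at h1
    exact h1
  set A : ℝ := (d ^ n) ^ (-(1 / p₁)) with hA
  set B : ℝ := (d ^ n) ^ (-(1 / p₂)) with hB
  have hA0 : 0 < A := by positivity
  have hB0 : 0 < B := by positivity
  -- pointwise bound on F
  set F : Rn n → ℝ := fun y => (b y - m) * testF n p₁ b c d y with hF
  have hFin : ∀ y ∈ Q, |F y| ≤ 2 * A * |b y - m| := by
    intro y hy
    have h1 := aux_sign_avg n (fun z => b z - m) c d hd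
    have h2 : |Real.sign (b y - m)| ≤ 1 := by
      rcases Real.sign_apply_eq (b y - m) with h | h | h <;> rw [h] <;> norm_num
    simp only [hF, testF]
    rw [indicator_of_mem hy, abs_mul, abs_mul, abs_of_pos hA0, mul_comm]
    apply mul_le_mul_of_nonneg_right _ (abs_nonneg _)
    rw [mul_comm 2 A]
    apply mul_le_mul_of_nonneg_left _ hA0.le
    refine (abs_sub _ _).trans ?_
    linarith
  have hFout : ∀ y, y ∉ Q → F y = 0 := by
    intro y hy
    simp only [hF, testF]
    rw [indicator_of_notMem hy, mul_zero]
  -- inner bound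
  have hinner : ∀ y, ‖∫ z, fracKernel n α x y z * (F y * testG n p₂ c d z)‖ ≤
      Q.indicator (fun y => (M * B * d ^ n * (2 * A)) * |b y - m|) y := by
    intro y
    by_cases hy : y ∈ Q
    · rw [indicator_of_mem hy]
      have hint : Integrable (Q.indicator fun _ : Rn n => M * |F y| * B) :=
        (integrable_indicator_iff hQm).2 (integrable_const (M * |F y| * B))
      refine (norm_integral_le_of_norm_le hint (Eventually.of_forall ?_)).trans ?_
      · intro z
        by_cases hz : z ∈ Q
        · rw [indicator_of_mem hz]
          simp only [testG]
          rw [indicator_of_mem hz, Real.norm_eq_abs, abs_mul, abs_mul, abs_of_pos hB0, ← mul_assoc]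
          have := aux_kernel n α hα₂ c d hd x y z hx hy hz
          gcongr
        · rw [indicator_of_notMem hz]
          simp only [testG]
          rw [indicator_of_notMem hz]
          simp
      · rw [integral_indicator hQm, setIntegral_const, hr, smul_eq_mul]
        have := hFin y hy
        calc d ^ n * (M * |F y| * B) ≤ d ^ n * (M * (2 * A * |b y - m|) * B) := by gcongr
          _ = _ := by ring
    · rw [indicator_of_notMem hy]
      simp [hFout y hy]
  unfold Iop
  rw [← Real.norm_eq_abs]
  refine (norm_integral_le_of_norm_le ((integrable_indicator_iff hQm).2 (Integrable.const_mul hbQ' _))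
    (Eventually.of_forall hinner)).trans ?_
  rw [integral_indicator hQm, integral_const_mul]
  have hexp : ∀ p : ℝ, 1 < p → 1 / conjExp p = 1 + -(1 / p) := by
    intro p hp
    unfold conjExp
    have : p ≠ 0 := by linarith
    have : p - 1 ≠ 0 := by linarith
    field_simp
    ring
  have hpow : (d ^ n) ^ (1 / conjExp p₁ + 1 / conjExp p₂) = (d ^ n * A) * (d ^ n * B) := by
    rw [hexp p₁ hp₁, hexp p₂ hp₂, Real.rpow_add hV, Real.rpow_add hV, Real.rpow_add hV,
      Real.rpow_one]
  rw [hpow]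
  calc M * B * d ^ n * (2 * A) * ∫ y in Q, |b y - m|
      ≤ M * B * d ^ n * (2 * A) * d ^ n := by gcongr
    _ = _ := by rw [hM]; ring
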